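/- Let G be a subgroup of S_n, c > 0, and for j ∈ {1,…,n} and φ : G → ℝ define Q^j φ(σ) = inf over probability measures p on G of ( ∑_y φ(y)p(y) + (1/c²)( ∑_y p(y)·1_{σ(j)≠y(j)} )² + (1/(2c²)) ∑_{k≠j} ( ∑_y p(y)·1_{σ(k)≠y(k)} )² ). Then for every j ∈ {1,…,n}, every φ : G → ℝ and every σ ∈ G, Q^j φ(σ) = Q^{σ(j)} φ^{(−1)}(σ⁻¹), where φ^{(−1)}(z) = φ(z⁻¹). -/

import Mathlib

attribute [local instance] Classical.propDecidable

noncomputable section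

/-- The infimum-convolution operator `Q^j φ`. -/
noncomputable def Qj {n : ℕ} (c : ℝ) (G : Subgroup (Equiv.Perm (Fin n))) (j : Fin n)
    (φ : Equiv.Perm (Fin n) → ℝ) (σ : Equiv.Perm (Fin n)) : ℝ :=
  sInf {w | ∃ p : Equiv.Perm (Fin n) → ℝ,
    (∀ y, 0 ≤ p y) ∧ (∀ y, y ∉ G → p y = 0) ∧ (∑ y, p y = 1) ∧
    w = (∑ y, φ y * p y) +
      (1 / c ^ 2) * (∑ y, p y * (if σ j ≠ y j then (1 : ℝ) else 0)) ^ 2 +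
      (1 / (2 * c ^ 2)) * ∑ k ∈ Finset.univ.filter (fun k : Fin n => k ≠ j),
        (∑ y, p y * (if σ k ≠ y k then (1 : ℝ) else 0)) ^ 2}

/-- The event `y (σ k) ≠ σ⁻¹ (σ k)` for `y` corresponds to `y⁻¹ k ≠ σ k` under inversion. -/
theorem sum_mul_ite_inv_apply {n : ℕ} (σ : Equiv.Perm (Fin n)) (p : Equiv.Perm (Fin n) → ℝ)
    (k : Fin n) :
    ∑ y, p y⁻¹ * (if σ⁻¹ (σ k) ≠ y (σ k) then (1 : ℝ) else 0) =
      ∑ y, p y * (if σ k ≠ y k then (1 : ℝ) else 0) := by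
  refine Fintype.sum_equiv (Equiv.inv _) _ _ fun y => ?_
  have h : σ⁻¹ (σ k) = y (σ k) ↔ σ k = y⁻¹ k := by
    rw [show σ⁻¹ (σ k) = k from σ.symm_apply_apply k, Equiv.Perm.eq_inv_iff_eq]
    exact eq_comm
  simp only [Equiv.inv_apply, ne_eq, h]

/-- Inversion identity for the operators `Q^j` (Lemma `inverse`). -/
theorem stmt17 {n : ℕ} (hn : 2 ≤ n) (G : Subgroup (Equiv.Perm (Fin n)))
    (c : ℝ) (hc : 0 < c) (j : Fin n) (φ : Equiv.Perm (Fin n) → ℝ)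
    (σ : Equiv.Perm (Fin n)) (hσ : σ ∈ G) :
    Qj c G j φ σ = Qj c G (σ j) (fun z => φ z⁻¹) σ⁻¹ := by
  unfold Qj
  congr 1
  ext w
  simp only [Set.mem_ofPred_eq]
  refine Equiv.exists_congr ((Equiv.inv (Equiv.Perm (Fin n))).arrowCongr (Equiv.refl ℝ))
    fun p => ?_
  have hp : ∀ y, (Equiv.inv (Equiv.Perm (Fin n))).arrowCongr (Equiv.refl ℝ) p y = p y⁻¹ :=
    fun _ => rfl
  have hpos : (∀ y, 0 ≤ p y⁻¹) ↔ ∀ y, 0 ≤ p y :=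
    (Equiv.inv (Equiv.Perm (Fin n))).forall_congr fun _ => Iff.rfl
  have hsupp : (∀ y, y ∉ G → p y⁻¹ = 0) ↔ ∀ y, y ∉ G → p y = 0 :=
    (Equiv.inv (Equiv.Perm (Fin n))).forall_congr fun y => by
      rw [Equiv.inv_apply, inv_mem_iff]
  have hsum : ∑ y, p y⁻¹ = ∑ y, p y :=
    Fintype.sum_equiv (Equiv.inv _) _ _ fun _ => rfl
  have hmean : ∑ y, φ y⁻¹ * p y⁻¹ = ∑ y, φ y * p y :=
    Fintype.sum_equiv (Equiv.inv _) _ _ fun _ => rfl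
  have hquad :
      ∑ k ∈ Finset.univ.filter (fun k : Fin n => k ≠ σ j),
        (∑ y, p y⁻¹ * (if σ⁻¹ k ≠ y k then (1 : ℝ) else 0)) ^ 2 =
      ∑ k ∈ Finset.univ.filter (fun k : Fin n => k ≠ j),
        (∑ y, p y * (if σ k ≠ y k then (1 : ℝ) else 0)) ^ 2 := by
    symm
    refine Finset.sum_equiv σ (fun k => by simp) fun k _ => ?_
    rw [sum_mul_ite_inv_apply]
  simp only [hp]
  rw [hpos, hsupp, hsum, hmean, hquad, sum_mul_ite_inv_apply]

end
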